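/- Existence under power-law bounds (Corollary 1.6). Let β>0 and let V : ℝ² → ℝ be locally integrable and radially symmetric, with constants C>0 and 0<R₁<R₂ such that V(x) ≥ C for a.e. R₁<‖x‖<R₂. Suppose there are positive constants C₀, C₁, C₂ and real numbers l₀, l₁, l₂ such that V⁻(x) ≤ C₀·‖x‖^{l₀} for a.e. ‖x‖ ≥ 1, V⁺(x) ≤ C₁·‖x‖^{l₁} for a.e. ‖x‖ ≤ 1, and V⁺(x) ≤ C₂·‖x‖^{l₂} for a.e. ‖x‖ ≥ 1, where l₀ < 2β-2, l₁ > β-2 and l₂ < β-2. Then there exists a locally integrable, radially symmetric ψ : ℝ² → ℝ, continuously differentiable on ℝ²∖{0} with ∫_{D(0,R)∖{0}} ‖∇ψ‖² dx < ∞ for every R>0, such that ψ is a weak solution of -Δψ = 4πβ·V·e^{ψ} on ℝ², ∫_{ℝ²} |V|·e^{ψ} dx < ∞ and ∫_{ℝ²} V·e^{ψ} dx = 1. -/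

import Mathlib

open MeasureTheory Real Filter Bornology Metric
open scoped NNReal

noncomputable section

abbrev R2 : Type := EuclideanSpace ℝ (Fin 2)

/-- The Laplacian of `f : ℝ² → ℝ`, via the second iterated Fréchet derivative. -/
def lap (f : R2 → ℝ) (x : R2) : ℝ :=
  ∑ i : Fin 2, iteratedFDeriv ℝ 2 f x ![EuclideanSpace.single i 1, EuclideanSpace.single i 1]

/-- `ψ` is a weak (distributional) solution of `-Δψ = g` on `ℝ²`:
for every smooth compactly supported test function `φ`, `∫ ψ·Δφ = -∫ g·φ`. -/
def IsWeakSol (ψ g : R2 → ℝ) : Prop :=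
  ∀ φ : R2 → ℝ, ContDiff ℝ (⊤ : ℕ∞) φ → HasCompactSupport φ →
    ∫ x : R2, ψ x * lap φ x = -∫ x : R2, g x * φ x

/-- `f` is radially symmetric. -/
def RadSym (f : R2 → ℝ) : Prop := ∀ x y : R2, ‖x‖ = ‖y‖ → f x = f y

theorem integrable_and_integral_le_of_tendsto {X : Type*} [MeasurableSpace X] {μ : Measure X}
    {q : ℕ → X → ℝ} {q₀ : X → ℝ} {l : ℝ} (hq : ∀ n, Integrable (q n) μ) (hq0 : ∀ n x, 0 ≤ q n x)
    (hlim : ∀ x, Tendsto (fun n => q n x) atTop (nhds (q₀ x)))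
    (hl : Tendsto (fun n => ∫ x, q n x ∂μ) atTop (nhds l)) :
    Integrable q₀ μ ∧ ∫ x, q₀ x ∂μ ≤ l := by
  have hm : AEStronglyMeasurable q₀ μ :=
    aestronglyMeasurable_of_tendsto_ae atTop (fun n => (hq n).aestronglyMeasurable)
      (Eventually.of_forall hlim)
  have h0 : ∀ x, 0 ≤ q₀ x := fun x => ge_of_tendsto' (hlim x) fun n => hq0 n x
  have hl0 : 0 ≤ l := ge_of_tendsto' hl fun n => integral_nonneg (hq0 n)
  have hle : ∫⁻ x, ENNReal.ofReal (q₀ x) ∂μ ≤ ENNReal.ofReal l := by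
    have h1 := lintegral_liminf_le' (μ := μ) (u := atTop) (f := fun n x => ENNReal.ofReal (q n x))
      (fun n => (hq n).aestronglyMeasurable.aemeasurable.ennreal_ofReal)
    have h2 : ∀ x, liminf (fun n => ENNReal.ofReal (q n x)) atTop = ENNReal.ofReal (q₀ x) :=
      fun x => (ENNReal.tendsto_ofReal (hlim x)).liminf_eq
    have h3 : liminf (fun n => ∫⁻ x, ENNReal.ofReal (q n x) ∂μ) atTop = ENNReal.ofReal l := by
      simp_rw [← ofReal_integral_eq_lintegral_ofReal (hq _) (Eventually.of_forall (hq0 _))]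
      exact (ENNReal.tendsto_ofReal hl).liminf_eq
    simpa only [h2, h3] using h1
  have hi : Integrable q₀ μ :=
    (lintegral_ofReal_ne_top_iff_integrable hm (Eventually.of_forall h0)).1
      (hle.trans_lt ENNReal.ofReal_lt_top).ne
  refine ⟨hi, ?_⟩
  rw [← ofReal_integral_eq_lintegral_ofReal hi (Eventually.of_forall h0)] at hle
  exact (ENNReal.ofReal_le_ofReal_iff hl0).1 hle

section Gibbs

variable {X : Type*} [MeasurableSpace X] {H : Type*} [NormedAddCommGroup H]
  [InnerProductSpace ℝ H]

theorem inner_le_mul_sq_add (x f : H) {δ : ℝ} (hδ : 0 < δ) :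
    inner ℝ x f ≤ δ * ‖x‖ ^ 2 + ‖f‖ ^ 2 / (4 * δ) := by
  have h1 := real_inner_le_norm x f
  have h2 : δ * ‖x‖ ^ 2 + ‖f‖ ^ 2 / (4 * δ) - ‖x‖ * ‖f‖
      = (2 * δ * ‖x‖ - ‖f‖) ^ 2 / (4 * δ) := by field_simp; ring
  have h3 : 0 ≤ (2 * δ * ‖x‖ - ‖f‖) ^ 2 / (4 * δ) := by positivity
  linarith

theorem integrable_mul_exp_inner {μ : Measure X} {K : X → ℝ} {e : X → H} {δ : ℝ} (hδ : 0 < δ)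
    (hK : AEStronglyMeasurable K μ) (he : ∀ f, AEStronglyMeasurable (fun x => inner ℝ (e x) f) μ)
    (hA : Integrable (fun x => max (K x) 0 * exp (δ * ‖e x‖ ^ 2)) μ) (f : H) :
    Integrable (fun x => max (K x) 0 * exp (inner ℝ (e x) f)) μ := by
  refine (hA.mul_const (exp (‖f‖ ^ 2 / (4 * δ)))).mono'
    ((hK.sup aestronglyMeasurable_const).mul (continuous_exp.comp_aestronglyMeasurable (he f))) ?_
  refine Eventually.of_forall fun x => ?_
  rw [Real.norm_eq_abs, abs_of_nonneg (by positivity), mul_assoc, ← exp_add]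
  have := inner_le_mul_sq_add (e x) f hδ
  gcongr

theorem integral_mul_exp_inner_le {μ : Measure X} {K : X → ℝ} {e : X → H} {δ : ℝ} (hδ : 0 < δ)
    (hA : Integrable (fun x => max (K x) 0 * exp (δ * ‖e x‖ ^ 2)) μ) (f : H)
    (hf : Integrable (fun x => K x * exp (inner ℝ (e x) f)) μ) :
    ∫ x, K x * exp (inner ℝ (e x) f) ∂μ ≤
      (∫ x, max (K x) 0 * exp (δ * ‖e x‖ ^ 2) ∂μ) * exp (‖f‖ ^ 2 / (4 * δ)) := by
  rw [← integral_mul_const]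
  refine integral_mono hf (hA.mul_const _) fun x => ?_
  have := inner_le_mul_sq_add (e x) f hδ
  dsimp only
  rw [mul_assoc, ← exp_add]
  have h2 : K x ≤ max (K x) 0 := le_max_left _ _
  gcongr

end Gibbs

theorem exists_subseq_weak_tendsto {H : Type*} [NormedAddCommGroup H] [InnerProductSpace ℝ H]
    [CompleteSpace H] [TopologicalSpace.SeparableSpace H] {f : ℕ → H} {B : ℝ}
    (hB : ∀ n, ‖f n‖ ≤ B) :
    ∃ (g : H) (L : ℝ) (φ : ℕ → ℕ), StrictMono φ ∧ Tendsto (fun n => ‖f (φ n)‖) atTop (nhds L) ∧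
      (∀ y, Tendsto (fun n => inner ℝ y (f (φ n))) atTop (nhds (inner ℝ y g))) ∧ ‖g‖ ≤ L := by
  obtain ⟨a, -, φ, hφ, ha⟩ := WeakDual.isSeqCompact_closedBall ℝ H 0 B
    (x := fun n => StrongDual.toWeakDual (InnerProductSpace.toDual ℝ H (f n)))
    (fun n => by simpa using hB n)
  obtain ⟨L, -, φ', hφ', hL⟩ := (isCompact_Icc (a := (0 : ℝ)) (b := B)).isSeqCompact
    (x := fun n => ‖f (φ n)‖) (fun n => ⟨norm_nonneg _, hB _⟩)
  set g : H := (InnerProductSpace.toDual ℝ H).symm (WeakDual.toStrongDual a) with hg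
  have hw : ∀ y, Tendsto (fun n => inner ℝ y (f (φ (φ' n)))) atTop (nhds (inner ℝ y g)) := by
    intro y
    have h1 := ((WeakDual.eval_continuous (𝕜 := ℝ) y).tendsto a).comp (ha.comp hφ'.tendsto_atTop)
    have h2 : a y = inner ℝ y g := by
      rw [real_inner_comm, hg, InnerProductSpace.toDual_symm_apply]; rfl
    rw [h2] at h1
    refine h1.congr fun n => ?_
    rw [real_inner_comm]; rfl
  refine ⟨g, L, φ ∘ φ', hφ.comp hφ', hL, hw, ?_⟩
  have h3 : ‖g‖ * ‖g‖ ≤ ‖g‖ * L := by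
    rw [← real_inner_self_eq_norm_mul_norm]
    exact le_of_tendsto_of_tendsto' (hw g) (hL.const_mul _) fun n => real_inner_le_norm _ _
  rcases (norm_nonneg g).eq_or_lt with h | h
  · rw [← h]; exact ge_of_tendsto' hL fun n => norm_nonneg _
  · exact le_of_mul_le_mul_left h3 h

section GibbsMax

variable {X : Type*} [MeasurableSpace X] {H : Type*} [NormedAddCommGroup H]
  [InnerProductSpace ℝ H]

/-- Existence of a maximizer of `f ↦ exp(-‖f‖²/(4β)) ∫ K exp ⟪e, f⟫` among all `f` for which
`K exp ⟪e, f⟫` is integrable. -/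
theorem exists_gibbs_maximizer [CompleteSpace H] [TopologicalSpace.SeparableSpace H]
    {μ : Measure X} {K : X → ℝ} {e : X → H} {β δ : ℝ} (hβ : 0 < β) (hδ : β < δ)
    (hK : AEStronglyMeasurable K μ) (he : ∀ f, AEStronglyMeasurable (fun x => inner ℝ (e x) f) μ)
    (hA : Integrable (fun x => max (K x) 0 * exp (δ * ‖e x‖ ^ 2)) μ)
    (h₀ : ∃ f, Integrable (fun x => K x * exp (inner ℝ (e x) f)) μ ∧
      0 < ∫ x, K x * exp (inner ℝ (e x) f) ∂μ) :
    ∃ f, Integrable (fun x => K x * exp (inner ℝ (e x) f)) μ ∧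
      0 < ∫ x, K x * exp (inner ℝ (e x) f) ∂μ ∧
      ∀ f', Integrable (fun x => K x * exp (inner ℝ (e x) f')) μ →
        exp (-(‖f'‖ ^ 2 / (4 * β))) * ∫ x, K x * exp (inner ℝ (e x) f') ∂μ ≤
        exp (-(‖f‖ ^ 2 / (4 * β))) * ∫ x, K x * exp (inner ℝ (e x) f) ∂μ := by
  have hδ0 : 0 < δ := hβ.trans hδ
  set A := ∫ x, max (K x) 0 * exp (δ * ‖e x‖ ^ 2) ∂μ with hAdef
  have hA0 : 0 ≤ A := integral_nonneg fun x => by positivity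
  set c : ℝ := 1 / (4 * β) - 1 / (4 * δ) with hc
  have hc0 : 0 < c := by
    rw [hc, sub_pos]; gcongr
  set P : H → ℝ := fun f => exp (-(‖f‖ ^ 2 / (4 * β))) * ∫ x, K x * exp (inner ℝ (e x) f) ∂μ
    with hP
  set S : Set H := {f | Integrable (fun x => K x * exp (inner ℝ (e x) f)) μ} with hS
  have hPle : ∀ f ∈ S, P f ≤ A * exp (-(c * ‖f‖ ^ 2)) := by
    intro f hf
    have h1 := integral_mul_exp_inner_le hδ0 hA f hf
    calc P f ≤ exp (-(‖f‖ ^ 2 / (4 * β))) * (A * exp (‖f‖ ^ 2 / (4 * δ))) := by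
          simp only [hP]; gcongr
      _ = A * exp (-(‖f‖ ^ 2 / (4 * β)) + ‖f‖ ^ 2 / (4 * δ)) := by rw [exp_add]; ring
      _ = _ := by congr 2; rw [hc]; ring
  have hbdd : BddAbove (P '' S) := by
    refine ⟨A, ?_⟩
    rintro _ ⟨f, hf, rfl⟩
    refine (hPle f hf).trans (mul_le_of_le_one_right hA0 ?_)
    rw [exp_le_one_iff]
    have : 0 ≤ c * ‖f‖ ^ 2 := by positivity
    linarith
  obtain ⟨f₀, hf₀, hpos⟩ := h₀
  have hsup0 : 0 < sSup (P '' S) :=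
    (mul_pos (exp_pos _) hpos).trans_le (le_csSup hbdd ⟨f₀, hf₀, rfl⟩)
  obtain ⟨u, -, hu, hmem⟩ := exists_seq_tendsto_sSup (S := P '' S) ⟨_, f₀, hf₀, rfl⟩ hbdd
  set s := sSup (P '' S) with hs
  choose f hfS hfu using hmem
  obtain ⟨N, hN⟩ := eventually_atTop.1 (hu.eventually (lt_mem_nhds (half_lt_self hsup0)))
  have hbound : ∀ n, ‖f (n + N)‖ ≤ 2 * A / (s * c) + 1 := by
    intro n
    have h1 := (hN (n + N) (Nat.le_add_left _ _)).trans_le ((hfu _).symm.le.trans (hPle _ (hfS _)))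
    set y := ‖f (n + N)‖
    have hy : 0 ≤ c * y ^ 2 := by positivity
    have h2 : exp (-(c * y ^ 2)) * (c * y ^ 2) ≤ 1 := by
      have h3 : c * y ^ 2 ≤ exp (c * y ^ 2) := by linarith [add_one_le_exp (c * y ^ 2)]
      calc _ ≤ exp (-(c * y ^ 2)) * exp (c * y ^ 2) := by gcongr
        _ = 1 := by rw [← exp_add]; simp
    have h4 : s / 2 * (c * y ^ 2) ≤ A := by
      calc _ ≤ A * exp (-(c * y ^ 2)) * (c * y ^ 2) := by gcongr
        _ = A * (exp (-(c * y ^ 2)) * (c * y ^ 2)) := by ring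
        _ ≤ A * 1 := by gcongr
        _ = A := mul_one A
    have h5 : y ^ 2 ≤ 2 * A / (s * c) := by
      rw [le_div_iff₀ (by positivity)]; nlinarith
    nlinarith [sq_nonneg (y - 1), sq_nonneg y]
  obtain ⟨g, L, φ, hφ, hL, hw, hgL⟩ := exists_subseq_weak_tendsto hbound
  set F : ℕ → H := fun n => f (φ n + N) with hF
  have hu' : Tendsto (fun n => P (F n)) atTop (nhds s) := by
    have h1 := hu.comp ((tendsto_add_atTop_nat N).comp hφ.tendsto_atTop)
    refine h1.congr fun n => ?_
    simp [hF, hfu]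
  have hFS : ∀ n, Integrable (fun x => K x * exp (inner ℝ (e x) (F n))) μ := fun n => hfS _
  have hZ : Tendsto (fun n => ∫ x, K x * exp (inner ℝ (e x) (F n)) ∂μ) atTop
      (nhds (exp (L ^ 2 / (4 * β)) * s)) := by
    have h1 : Tendsto (fun n => exp (‖F n‖ ^ 2 / (4 * β)) * P (F n)) atTop
        (nhds (exp (L ^ 2 / (4 * β)) * s)) :=
      ((continuous_exp.tendsto _).comp ((hL.pow 2).div_const _)).mul hu'
    refine h1.congr fun n => ?_
    simp only [hP]
    rw [← mul_assoc, ← exp_add]; simp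
  have hp : ∀ f, Integrable (fun x => max (K x) 0 * exp (inner ℝ (e x) f)) μ :=
    integrable_mul_exp_inner hδ0 hK he hA
  have hpt : ∀ x, Tendsto (fun n => exp (inner ℝ (e x) (F n))) atTop
      (nhds (exp (inner ℝ (e x) g))) := fun x => (continuous_exp.tendsto _).comp (hw (e x))
  have hpl : Tendsto (fun n => ∫ x, max (K x) 0 * exp (inner ℝ (e x) (F n)) ∂μ) atTop
      (nhds (∫ x, max (K x) 0 * exp (inner ℝ (e x) g) ∂μ)) := by
    refine tendsto_integral_of_dominated_convergence
      (fun x => max (K x) 0 * exp (δ * ‖e x‖ ^ 2) *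
        exp ((2 * A / (s * c) + 1) ^ 2 / (4 * δ))) (fun n => (hp _).aestronglyMeasurable)
      (hA.mul_const _) (fun n => Eventually.of_forall fun x => ?_)
      (Eventually.of_forall fun x => (hpt x).const_mul _)
    rw [Real.norm_eq_abs, abs_of_nonneg (by positivity), mul_assoc, ← exp_add]
    have h1 := inner_le_mul_sq_add (e x) (F n) hδ0
    have h2 : ‖F n‖ ^ 2 ≤ (2 * A / (s * c) + 1) ^ 2 := by
      have := hbound (φ n); gcongr
    have h3 : ‖F n‖ ^ 2 / (4 * δ) ≤ (2 * A / (s * c) + 1) ^ 2 / (4 * δ) := by gcongr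
    gcongr
    linarith
  have hdec : ∀ f x, max (K x) 0 * exp (inner ℝ (e x) f) - K x * exp (inner ℝ (e x) f)
      = max (-K x) 0 * exp (inner ℝ (e x) f) := by
    intro f x
    rw [← sub_mul]
    congr 1
    have := max_zero_sub_eq_self (K x)
    rw [max_comm (K x), max_comm (-K x)] at *
    linarith
  obtain ⟨hq, hql⟩ := integrable_and_integral_le_of_tendsto (μ := μ)
    (q := fun n x => max (-K x) 0 * exp (inner ℝ (e x) (F n)))
    (q₀ := fun x => max (-K x) 0 * exp (inner ℝ (e x) g))
    (fun n => ((hp (F n)).sub (hFS n)).congr (Eventually.of_forall fun x => hdec (F n) x))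
    (fun n x => by positivity) (fun x => (hpt x).const_mul _)
    ((hpl.sub hZ).congr fun n => by
      rw [← integral_sub (hp (F n)) (hFS n)]
      exact integral_congr_ae (Eventually.of_forall fun x => hdec (F n) x))
  have hgS : Integrable (fun x => K x * exp (inner ℝ (e x) g)) μ :=
    ((hp g).sub hq).congr (Eventually.of_forall fun x => by
      simp only [Pi.sub_apply]; linarith [hdec g x])
  have hgZ : exp (L ^ 2 / (4 * β)) * s ≤ ∫ x, K x * exp (inner ℝ (e x) g) ∂μ := by
    have h1 : ∫ x, max (-K x) 0 * exp (inner ℝ (e x) g) ∂μ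
        = ∫ x, max (K x) 0 * exp (inner ℝ (e x) g) ∂μ - ∫ x, K x * exp (inner ℝ (e x) g) ∂μ := by
      rw [← integral_sub (hp g) hgS]
      exact integral_congr_ae (Eventually.of_forall fun x => (hdec g x).symm)
    linarith
  have hgs : s ≤ P g := by
    have h1 : exp (‖g‖ ^ 2 / (4 * β)) * s ≤ ∫ x, K x * exp (inner ℝ (e x) g) ∂μ := by
      refine le_trans ?_ hgZ
      gcongr
    calc s = exp (-(‖g‖ ^ 2 / (4 * β))) * (exp (‖g‖ ^ 2 / (4 * β)) * s) := by
          rw [← mul_assoc, ← exp_add]; simp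
      _ ≤ P g := by simp only [hP]; gcongr
  refine ⟨g, hgS, (by positivity : 0 < exp (L ^ 2 / (4 * β)) * s).trans_le hgZ, fun f' hf' => ?_⟩
  exact (le_csSup hbdd ⟨f', hf', rfl⟩).trans hgs

/-- The Euler–Lagrange equation of a maximizer, in the directions `g` that give bounded
perturbations. -/
theorem gibbs_euler_lagrange {μ : Measure X} {K : X → ℝ} {e : X → H} {β : ℝ} (hβ : 0 < β)
    (he : ∀ f, AEStronglyMeasurable (fun x => inner ℝ (e x) f) μ) {f g : H} {M : ℝ}
    (hf : Integrable (fun x => K x * exp (inner ℝ (e x) f)) μ)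
    (hpos : 0 < ∫ x, K x * exp (inner ℝ (e x) f) ∂μ)
    (hmax : ∀ f', Integrable (fun x => K x * exp (inner ℝ (e x) f')) μ →
        exp (-(‖f'‖ ^ 2 / (4 * β))) * ∫ x, K x * exp (inner ℝ (e x) f') ∂μ ≤
        exp (-(‖f‖ ^ 2 / (4 * β))) * ∫ x, K x * exp (inner ℝ (e x) f) ∂μ)
    (hg : ∀ x, |inner ℝ (e x) g| ≤ M) :
    inner ℝ f g = 2 * β * ((∫ x, K x * exp (inner ℝ (e x) f) * inner ℝ (e x) g ∂μ) /
      ∫ x, K x * exp (inner ℝ (e x) f) ∂μ) := by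
  set Z := ∫ x, K x * exp (inner ℝ (e x) f) ∂μ with hZ
  have hform : ∀ (t : ℝ) x, K x * exp (inner ℝ (e x) (f + t • g))
      = K x * exp (inner ℝ (e x) f) * exp (t * inner ℝ (e x) g) := by
    intro t x
    rw [inner_add_right, inner_smul_right, exp_add]; ring
  have hint : ∀ t : ℝ, Integrable (fun x => K x * exp (inner ℝ (e x) f) *
      exp (t * inner ℝ (e x) g)) μ := by
    intro t
    refine hf.mul_bdd (c := exp (|t| * M))
      (continuous_exp.comp_aestronglyMeasurable ((he g).const_mul t))
      (Eventually.of_forall fun x => ?_)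
    rw [Real.norm_eq_abs, abs_of_pos (exp_pos _), exp_le_exp]
    calc t * inner ℝ (e x) g ≤ |t| * |inner ℝ (e x) g| := by rw [← abs_mul]; exact le_abs_self _
      _ ≤ |t| * M := by gcongr; exact hg x
  have hder : HasDerivAt (fun t : ℝ => ∫ x, K x * exp (inner ℝ (e x) f) *
      exp (t * inner ℝ (e x) g) ∂μ)
      (∫ x, K x * exp (inner ℝ (e x) f) * (exp (0 * inner ℝ (e x) g) * inner ℝ (e x) g) ∂μ) 0 := by
    refine (hasDerivAt_integral_of_dominated_loc_of_deriv_le (Metric.ball_mem_nhds (0 : ℝ) one_pos)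
      (F := fun t x => K x * exp (inner ℝ (e x) f) * exp (t * inner ℝ (e x) g))
      (F' := fun t x => K x * exp (inner ℝ (e x) f) *
        (exp (t * inner ℝ (e x) g) * inner ℝ (e x) g))
      (bound := fun x => |K x * exp (inner ℝ (e x) f)| * (exp M * M))
      (Eventually.of_forall fun t => (hint t).aestronglyMeasurable) (hint 0) ?_ ?_
      (hf.abs.mul_const _) ?_).2
    · exact hf.aestronglyMeasurable.mul ((continuous_exp.comp_aestronglyMeasurable
        ((he g).const_mul 0)).mul (he g))
    · refine Eventually.of_forall fun x t ht => ?_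
      rw [norm_mul, norm_mul (exp _), Real.norm_eq_abs, Real.norm_eq_abs, Real.norm_eq_abs,
        abs_of_pos (exp_pos (t * _))]
      rw [mem_ball_zero_iff, Real.norm_eq_abs] at ht
      have h1 := hg x
      have h2 : t * inner ℝ (e x) g ≤ M := by
        calc t * inner ℝ (e x) g ≤ |t| * |inner ℝ (e x) g| := by
              rw [← abs_mul]; exact le_abs_self _
          _ ≤ 1 * |inner ℝ (e x) g| := by gcongr
          _ ≤ M := by rw [one_mul]; exact h1
      gcongr
    · refine Eventually.of_forall fun x t _ => ?_
      exact (((hasDerivAt_id t).mul_const (inner ℝ (e x) g)).exp.const_mul _).congr_deriv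
        (by simp)
  simp only [zero_mul, exp_zero, one_mul] at hder
  have hnorm : ∀ t : ℝ, ‖f + t • g‖ ^ 2 = ‖f‖ ^ 2 + t * (2 * inner ℝ f g) + t ^ 2 * ‖g‖ ^ 2 := by
    intro t
    rw [norm_add_sq_real, inner_smul_right, norm_smul, mul_pow, Real.norm_eq_abs, sq_abs]; ring
  have hder2 : HasDerivAt (fun t : ℝ => exp (-(‖f + t • g‖ ^ 2 / (4 * β))))
      (exp (-(‖f‖ ^ 2 / (4 * β))) * -(2 * inner ℝ f g / (4 * β))) 0 := by
    simp_rw [hnorm]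
    have h1 : HasDerivAt (fun t : ℝ => ‖f‖ ^ 2 + t * (2 * inner ℝ f g) + t ^ 2 * ‖g‖ ^ 2)
        (2 * inner ℝ f g) 0 := by
      have := (((hasDerivAt_id (0 : ℝ)).mul_const (2 * inner ℝ f g)).const_add (‖f‖ ^ 2)).add
        (((hasDerivAt_id (0 : ℝ)).pow 2).mul_const (‖g‖ ^ 2))
      exact this.congr_deriv (by simp)
    exact ((h1.div_const (4 * β)).neg.exp).congr_deriv (by simp)
  have hder3 := hder2.mul hder
  have hloc : IsLocalMax ((fun t : ℝ => exp (-(‖f + t • g‖ ^ 2 / (4 * β)))) *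
      fun t : ℝ => ∫ x, K x * exp (inner ℝ (e x) f) * exp (t * inner ℝ (e x) g) ∂μ) 0 := by
    refine Eventually.of_forall fun t => ?_
    have h1 := hmax (f + t • g) ((hint t).congr (Eventually.of_forall fun x => (hform t x).symm))
    simp only [hform] at h1
    simpa using h1
  have hz := hloc.hasDerivAt_eq_zero hder3
  simp only [zero_smul, add_zero, zero_mul, exp_zero, mul_one, ← hZ] at hz
  have hE := exp_pos (-(‖f‖ ^ 2 / (4 * β)))
  have hz2 : -(2 * inner ℝ f g / (4 * β)) * Z
      + ∫ x, K x * exp (inner ℝ (e x) f) * inner ℝ (e x) g ∂μ = 0 := by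
    have : exp (-(‖f‖ ^ 2 / (4 * β))) * (-(2 * inner ℝ f g / (4 * β)) * Z
      + ∫ x, K x * exp (inner ℝ (e x) f) * inner ℝ (e x) g ∂μ) = 0 := by rw [← hz]; ring
    exact (mul_eq_zero.1 this).resolve_left hE.ne'
  have hz3 : (∫ x, K x * exp (inner ℝ (e x) f) * inner ℝ (e x) g ∂μ)
    = 2 * inner ℝ f g / (4 * β) * Z := by linarith
  rw [hz3]
  field_simp
  ring

end GibbsMax

/-- The signed indicator function of the interval between `0` and `t`, as an element of `L²(ℝ)`. -/
def signedIndicator (t : ℝ) : Lp ℝ 2 (volume : Measure ℝ) :=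
  indicatorConstLp 2 (measurableSet_Ioc (a := 0) (b := t)) measure_Ioc_lt_top.ne 1 -
    indicatorConstLp 2 (measurableSet_Ioc (a := t) (b := 0)) measure_Ioc_lt_top.ne 1

theorem inner_signedIndicator (t : ℝ) (f : Lp ℝ 2 (volume : Measure ℝ)) :
    inner ℝ (signedIndicator t) f = ∫ s in (0)..t, f s := by
  rw [signedIndicator, inner_sub_left, L2.inner_indicatorConstLp_one, L2.inner_indicatorConstLp_one,
    intervalIntegral]

theorem inner_signedIndicator_signedIndicator (t b : ℝ) :
    inner ℝ (signedIndicator t) (signedIndicator b) = max b 0 + max t 0 - max b t := by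
  simp only [signedIndicator, inner_sub_left, inner_sub_right]
  have hfin : ∀ a b : ℝ, volume (Set.Ioc a b) ≠ ⊤ := fun _ _ => measure_Ioc_lt_top.ne
  have key : ∀ a b c d : ℝ, inner ℝ
      (indicatorConstLp 2 (measurableSet_Ioc (a := a) (b := b)) (hfin a b) (1 : ℝ))
      (indicatorConstLp 2 (measurableSet_Ioc (a := c) (b := d)) (hfin c d) (1 : ℝ)) =
      volume.real (Set.Ioc a b ∩ Set.Ioc c d) := fun a b c d => by
    rw [L2.inner_indicatorConstLp_indicatorConstLp (hμs := hfin a b) (hμt := hfin c d)]; simp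
  rw [key, key, key, key]
  simp only [Set.Ioc_inter_Ioc, volume_real_Ioc]
  rcases le_total t 0 with h1 | h1 <;> rcases le_total b 0 with h2 | h2 <;>
    rcases le_total b t with h3 | h3 <;> simp [h1, h2, h3] <;> linarith

theorem norm_signedIndicator_sq (t : ℝ) : ‖signedIndicator t‖ ^ 2 = |t| := by
  rw [← real_inner_self_eq_norm_sq, inner_signedIndicator_signedIndicator, max_self]
  rcases le_total t 0 with h | h
  · rw [max_eq_right h, abs_of_nonpos h]; ring
  · rw [max_eq_left h, abs_of_nonneg h]; ring

theorem locallyIntegrable_coe_Lp_two (f : Lp ℝ 2 (volume : Measure ℝ)) :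
    LocallyIntegrable f volume :=
  (Lp.memLp f).locallyIntegrable (by norm_num)

theorem continuous_inner_signedIndicator (f : Lp ℝ 2 (volume : Measure ℝ)) :
    Continuous fun t => inner ℝ (signedIndicator t) f := by
  simp only [inner_signedIndicator]
  exact intervalIntegral.continuous_primitive
    (fun _ _ => ((locallyIntegrable_coe_Lp_two f).integrableOn_isCompact
      isCompact_uIcc).intervalIntegrable) 0

theorem integrable_sq_of_hasDerivAt_inner_signedIndicator {f : Lp ℝ 2 (volume : Measure ℝ)}
    {w' : ℝ → ℝ} (h : ∀ b ≠ 0, HasDerivAt (fun t => inner ℝ (signedIndicator t) f) (w' b) b) :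
    Integrable fun b => w' b ^ 2 := by
  have h1 := LocallyIntegrable.ae_hasDerivAt_integral (locallyIntegrable_coe_Lp_two f)
  have h2 : ∀ᵐ b : ℝ, b ≠ 0 := by simp [ae_iff]
  refine (Lp.memLp f).integrable_sq.congr ?_
  filter_upwards [h1, h2] with b hb hb0
  have h3 := h b hb0
  simp only [inner_signedIndicator] at h3
  simp only [h3.unique (hb 0)]

/-- The unit vector of `ℝ²` at polar angle `θ`. -/
def circleVec (θ : ℝ) : R2 := !₂[cos θ, sin θ]

/-- The derivative of `circleVec`. -/
def circleTangent (θ : ℝ) : R2 := !₂[-sin θ, cos θ]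

theorem circleVec_eq (θ : ℝ) :
    circleVec θ = cos θ • EuclideanSpace.single 0 1 + sin θ • EuclideanSpace.single 1 1 := by
  ext i; fin_cases i <;> simp [circleVec]

theorem circleTangent_eq (θ : ℝ) : circleTangent θ =
    (-sin θ) • EuclideanSpace.single 0 1 + cos θ • EuclideanSpace.single 1 1 := by
  ext i; fin_cases i <;> simp [circleTangent]

theorem hasDerivAt_circleVec (θ : ℝ) : HasDerivAt circleVec (circleTangent θ) θ := by
  rw [circleTangent_eq, funext circleVec_eq]
  exact ((hasDerivAt_cos θ).smul_const _).add ((hasDerivAt_sin θ).smul_const _)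

theorem hasDerivAt_circleTangent (θ : ℝ) : HasDerivAt circleTangent (-circleVec θ) θ := by
  rw [circleVec_eq, funext circleTangent_eq, neg_add, ← neg_smul, ← neg_smul]
  exact ((hasDerivAt_sin θ).neg.smul_const _).add ((hasDerivAt_cos θ).smul_const _)

theorem continuous_circleVec : Continuous circleVec :=
  continuous_iff_continuousAt.2 fun θ => (hasDerivAt_circleVec θ).continuousAt

theorem continuous_circleTangent : Continuous circleTangent :=
  continuous_iff_continuousAt.2 fun θ => (hasDerivAt_circleTangent θ).continuousAt

theorem norm_circleVec (θ : ℝ) : ‖circleVec θ‖ = 1 := by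
  simp [circleVec, EuclideanSpace.norm_eq, Fin.sum_univ_two]

theorem circleVec_pi : circleVec π = circleVec (-π) := by simp [circleVec]

theorem circleTangent_pi : circleTangent π = circleTangent (-π) := by simp [circleTangent]

theorem norm_smul_circleVec {r : ℝ} (hr : 0 ≤ r) (θ : ℝ) : ‖r • circleVec θ‖ = r := by
  rw [norm_smul, norm_circleVec, mul_one, Real.norm_of_nonneg hr]

theorem integral_R2_eq_polar (F : R2 → ℝ) :
    ∫ x, F x = ∫ p in Set.Ioi (0 : ℝ) ×ˢ Set.Ioo (-π) π, p.1 * F (p.1 • circleVec p.2) := by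
  have h1 : MeasurePreserving (MeasurableEquiv.finTwoArrow.symm.trans
      (MeasurableEquiv.toLp 2 (Fin 2 → ℝ)) : ℝ × ℝ ≃ᵐ R2) volume volume :=
    (PiLp.volume_preserving_toLp (Fin 2)).comp (volume_preserving_finTwoArrow ℝ).symm
  rw [← h1.integral_comp' F, ← integral_comp_polarCoord_symm]
  refine setIntegral_congr_fun (measurableSet_Ioi.prod measurableSet_Ioo) fun p _ => ?_
  simp only [smul_eq_mul]
  congr 2
  ext i
  fin_cases i <;> simp [circleVec]

theorem lap_eq_polar (φ : R2 → ℝ) (x : R2) (θ : ℝ) :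
    lap φ x = fderiv ℝ (fderiv ℝ φ) x (circleVec θ) (circleVec θ) +
      fderiv ℝ (fderiv ℝ φ) x (circleTangent θ) (circleTangent θ) := by
  simp only [lap, iteratedFDeriv_two_apply, Fin.sum_univ_two, Matrix.cons_val_zero,
    Matrix.cons_val_one]
  rw [circleVec_eq, circleTangent_eq]
  simp only [map_add, map_smul, add_apply, FunLike.coe_smul, Pi.smul_apply, smul_eq_mul]
  linear_combination (-(fderiv ℝ (fderiv ℝ φ) x (EuclideanSpace.single 0 1)
      (EuclideanSpace.single 0 1)) - fderiv ℝ (fderiv ℝ φ) x (EuclideanSpace.single 1 1)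
      (EuclideanSpace.single 1 1)) * sin_sq_add_cos_sq θ

section Polar

variable {φ : R2 → ℝ}

theorem hasDerivAt_radial (hφ : ContDiff ℝ (⊤ : ℕ∞) φ) (r θ : ℝ) :
    HasDerivAt (fun r : ℝ => φ (r • circleVec θ))
      (fderiv ℝ φ (r • circleVec θ) (circleVec θ)) r := by
  have h1 : HasDerivAt (fun r : ℝ => r • circleVec θ) (circleVec θ) r := by
    simpa using (hasDerivAt_id r).smul_const (circleVec θ)
  exact ((hφ.differentiable (by simp)) _).hasFDerivAt.comp_hasDerivAt r h1

theorem differentiable_fderiv (hφ : ContDiff ℝ (⊤ : ℕ∞) φ) : Differentiable ℝ (fderiv ℝ φ) :=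
  (hφ.fderiv_right (m := 1) (by norm_cast)).differentiable (by simp)

theorem continuous_fderiv_fderiv (hφ : ContDiff ℝ (⊤ : ℕ∞) φ) :
    Continuous (fderiv ℝ (fderiv ℝ φ)) :=
  (hφ.fderiv_right (m := 1) (by norm_cast)).continuous_fderiv (by simp)

theorem hasDerivAt_radial_flux (hφ : ContDiff ℝ (⊤ : ℕ∞) φ) (r θ : ℝ) :
    HasDerivAt (fun r : ℝ => r * fderiv ℝ φ (r • circleVec θ) (circleVec θ))
      (fderiv ℝ φ (r • circleVec θ) (circleVec θ) +
        r * fderiv ℝ (fderiv ℝ φ) (r • circleVec θ) (circleVec θ) (circleVec θ)) r := by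
  have h1 : HasDerivAt (fun r : ℝ => r • circleVec θ) (circleVec θ) r := by
    simpa using (hasDerivAt_id r).smul_const (circleVec θ)
  have h2 := ((differentiable_fderiv hφ) _).hasFDerivAt.comp_hasDerivAt r h1
  have h3 := h2.clm_apply (hasDerivAt_const r (circleVec θ))
  exact ((hasDerivAt_id r).mul h3).congr_deriv (by simp)

theorem hasDerivAt_angular (hφ : ContDiff ℝ (⊤ : ℕ∞) φ) (r θ : ℝ) :
    HasDerivAt (fun θ : ℝ => fderiv ℝ φ (r • circleVec θ) (circleTangent θ))
      (r * fderiv ℝ (fderiv ℝ φ) (r • circleVec θ) (circleTangent θ) (circleTangent θ) -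
        fderiv ℝ φ (r • circleVec θ) (circleVec θ)) θ := by
  have h1 := (hasDerivAt_circleVec θ).const_smul r
  have h2 := ((differentiable_fderiv hφ) _).hasFDerivAt.comp_hasDerivAt θ h1
  exact (h2.clm_apply (hasDerivAt_circleTangent θ)).congr_deriv (by simp [sub_eq_add_neg])

theorem exists_radius_support (hsupp : HasCompactSupport φ) (ρ : ℝ) :
    ∃ R, ρ < R ∧ ∀ x, R ≤ ‖x‖ → φ x = 0 ∧ fderiv ℝ φ x = 0 ∧ fderiv ℝ (fderiv ℝ φ) x = 0 := by
  obtain ⟨R, hR, hsub⟩ := hsupp.isBounded.subset_ball_lt ρ 0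
  refine ⟨R, hR, fun x hx => ?_⟩
  have h1 : x ∉ tsupport φ := fun h => by
    have := hsub h
    rw [mem_ball_zero_iff] at this
    linarith
  have h2 : x ∉ tsupport (fderiv ℝ φ) := fun h => h1 (tsupport_fderiv_subset ℝ h)
  have h3 : x ∉ tsupport (fderiv ℝ (fderiv ℝ φ)) := fun h => h2 (tsupport_fderiv_subset ℝ h)
  exact ⟨image_eq_zero_of_notMem_tsupport h1, image_eq_zero_of_notMem_tsupport h2,
    image_eq_zero_of_notMem_tsupport h3⟩

theorem continuous_log_max {ρ : ℝ} (hρ : 0 < ρ) : Continuous fun r : ℝ => log (max r ρ) :=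
  (continuous_id.max continuous_const).log fun _ => (lt_max_of_lt_right hρ).ne'

theorem integral_log_max_mul_radial (hφ : ContDiff ℝ (⊤ : ℕ∞) φ) {ρ R : ℝ}
    (hρ : 0 < ρ) (hR : ρ < R)
    (hsupp : ∀ x, R ≤ ‖x‖ → φ x = 0 ∧ fderiv ℝ φ x = 0 ∧ fderiv ℝ (fderiv ℝ φ) x = 0) (θ : ℝ) :
    ∫ r in Set.Ioi (0 : ℝ), log (max r ρ) * (fderiv ℝ φ (r • circleVec θ) (circleVec θ) +
        r * fderiv ℝ (fderiv ℝ φ) (r • circleVec θ) (circleVec θ) (circleVec θ)) =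
      φ (ρ • circleVec θ) := by
  set A : ℝ → ℝ := fun r => r * fderiv ℝ φ (r • circleVec θ) (circleVec θ) with hA
  set A' : ℝ → ℝ := fun r => fderiv ℝ φ (r • circleVec θ) (circleVec θ) +
        r * fderiv ℝ (fderiv ℝ φ) (r • circleVec θ) (circleVec θ) (circleVec θ) with hA'
  have hder : ∀ r, HasDerivAt A (A' r) r := fun r => hasDerivAt_radial_flux hφ r θ
  have hcont : Continuous A' := by
    have h1 := (hφ.continuous_fderiv (by simp))
    have h2 := continuous_fderiv_fderiv hφ
    fun_prop
  have hR0 : 0 < R := hρ.trans hR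
  have hzero : ∀ r, R ≤ r → A' r = 0 := by
    intro r hr
    obtain ⟨-, h2, h3⟩ := hsupp (r • circleVec θ)
      (by rwa [norm_smul_circleVec (hR0.le.trans hr)])
    simp [hA', h2, h3]
  have hmc : Continuous fun r => log (max r ρ) * A' r := (continuous_log_max hρ).mul hcont
  have e1 : ∫ r in Set.Ioi (0 : ℝ), log (max r ρ) * A' r = ∫ r in (0)..R, log (max r ρ) * A' r := by
    rw [intervalIntegral.integral_of_le hR0.le]
    refine setIntegral_eq_of_subset_of_forall_sdiff_eq_zero measurableSet_Ioi
      (fun x hx => hx.1) fun x hx => ?_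
    have : R ≤ x := by
      by_contra! h
      exact hx.2 ⟨hx.1, h.le⟩
    simp [hzero x this]
  have e2 : ∫ r in (0)..ρ, log (max r ρ) * A' r = log ρ * A ρ := by
    have : ∫ r in (0)..ρ, log (max r ρ) * A' r = ∫ r in (0)..ρ, log ρ * A' r := by
      refine intervalIntegral.integral_congr fun r hr => ?_
      rw [Set.uIcc_of_le hρ.le] at hr
      simp only [max_eq_right hr.2]
    rw [this, intervalIntegral.integral_const_mul,
      intervalIntegral.integral_eq_sub_of_hasDerivAt (fun r _ => hder r)
        (hcont.intervalIntegrable _ _)]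
    simp [hA]
  have e3 : ∫ r in ρ..R, log (max r ρ) * A' r = φ (ρ • circleVec θ) - log ρ * A ρ := by
    obtain ⟨h1, h2, -⟩ := hsupp (R • circleVec θ) (by rw [norm_smul_circleVec hR0.le])
    rw [intervalIntegral.integral_eq_sub_of_hasDerivAt
      (f := fun r => log r * A r - φ (r • circleVec θ)) (fun r hr => ?_)
      (hmc.intervalIntegrable _ _)]
    · simp [h1, h2, hA]
    · rw [Set.uIcc_of_le hR.le] at hr
      have hr0 : 0 < r := hρ.trans_le hr.1
      rw [max_eq_left hr.1]
      refine (((hasDerivAt_log hr0.ne').mul (hder r)).sub (hasDerivAt_radial hφ r θ)).congr_deriv ?_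
      simp only [hA]
      field_simp
      ring
  rw [e1, ← intervalIntegral.integral_add_adjacent_intervals (hmc.intervalIntegrable 0 ρ)
    (hmc.intervalIntegrable ρ R), e2, e3]
  ring

theorem integral_angular_eq_zero (hφ : ContDiff ℝ (⊤ : ℕ∞) φ) (r : ℝ) :
    ∫ θ in Set.Ioo (-π) π, (r * fderiv ℝ (fderiv ℝ φ) (r • circleVec θ) (circleTangent θ)
      (circleTangent θ) - fderiv ℝ φ (r • circleVec θ) (circleVec θ)) = 0 := by
  have hcont : Continuous fun θ => r * fderiv ℝ (fderiv ℝ φ) (r • circleVec θ) (circleTangent θ)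
      (circleTangent θ) - fderiv ℝ φ (r • circleVec θ) (circleVec θ) := by
    have h1 := (hφ.continuous_fderiv (by simp))
    have h2 := continuous_fderiv_fderiv hφ
    have h3 := continuous_circleVec
    have h4 := continuous_circleTangent
    fun_prop
  rw [← integral_Ioc_eq_integral_Ioo, ← intervalIntegral.integral_of_le (by linarith [pi_pos]),
    intervalIntegral.integral_eq_sub_of_hasDerivAt (fun θ _ => hasDerivAt_angular hφ r θ)
      (hcont.intervalIntegrable _ _), circleVec_pi, circleTangent_pi, sub_self]

/-- The logarithmic potential of a circle, tested against `φ`. -/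
theorem integral_log_max_mul_lap (hφ : ContDiff ℝ (⊤ : ℕ∞) φ) (hsupp : HasCompactSupport φ)
    {ρ : ℝ} (hρ : 0 < ρ) :
    ∫ x, log (max ‖x‖ ρ) * lap φ x = ∫ θ in Set.Ioo (-π) π, φ (ρ • circleVec θ) := by
  obtain ⟨R, hR, hz⟩ := exists_radius_support hsupp ρ
  have hR0 : 0 < R := hρ.trans hR
  have c1 := (hφ.continuous_fderiv (by simp))
  have c2 := continuous_fderiv_fderiv hφ
  have c3 := continuous_circleVec
  have c4 := continuous_circleTangent
  have c5 := continuous_log_max hρ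
  set a : ℝ × ℝ → ℝ := fun p => log (max p.1 ρ) *
    (fderiv ℝ φ (p.1 • circleVec p.2) (circleVec p.2) +
      p.1 * fderiv ℝ (fderiv ℝ φ) (p.1 • circleVec p.2) (circleVec p.2) (circleVec p.2)) with ha
  set b : ℝ × ℝ → ℝ := fun p => log (max p.1 ρ) *
    (p.1 * fderiv ℝ (fderiv ℝ φ) (p.1 • circleVec p.2) (circleTangent p.2) (circleTangent p.2) -
      fderiv ℝ φ (p.1 • circleVec p.2) (circleVec p.2)) with hb
  have hca : Continuous a := (c5.comp continuous_fst).mul (by fun_prop)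
  have hcb : Continuous b := (c5.comp continuous_fst).mul (by fun_prop)
  have hint : ∀ g : ℝ × ℝ → ℝ, Continuous g → (∀ p : ℝ × ℝ, R ≤ p.1 → g p = 0) →
      IntegrableOn g (Set.Ioi (0 : ℝ) ×ˢ Set.Ioo (-π) π) := by
    intro g hg hg0
    have h1 : IntegrableOn g (Set.Icc (0 : ℝ) R ×ˢ Set.Icc (-π) π) :=
      hg.continuousOn.integrableOn_compact (isCompact_Icc.prod isCompact_Icc)
    refine h1.of_forall_sdiff_eq_zero (measurableSet_Ioi.prod measurableSet_Ioo) fun p hp => ?_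
    refine hg0 p ?_
    by_contra! h
    exact hp.2 ⟨⟨le_of_lt hp.1.1, h.le⟩, ⟨hp.1.2.1.le, hp.1.2.2.le⟩⟩
  have hz' : ∀ p : ℝ × ℝ, R ≤ p.1 → fderiv ℝ φ (p.1 • circleVec p.2) = 0 ∧
      fderiv ℝ (fderiv ℝ φ) (p.1 • circleVec p.2) = 0 := fun p hp =>
    (hz _ (by rwa [norm_smul_circleVec (hR0.le.trans hp)])).2
  have ia := hint a hca fun p hp => by simp [ha, hz' p hp]
  have ib := hint b hcb fun p hp => by simp [hb, hz' p hp]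
  have e1 : ∫ x, log (max ‖x‖ ρ) * lap φ x =
      ∫ p in Set.Ioi (0 : ℝ) ×ˢ Set.Ioo (-π) π, (a p + b p) := by
    rw [integral_R2_eq_polar]
    refine setIntegral_congr_fun (measurableSet_Ioi.prod measurableSet_Ioo) fun p hp => ?_
    have hp1 : 0 < p.1 := hp.1
    simp only [norm_smul_circleVec hp1.le, lap_eq_polar φ _ p.2, ha, hb]
    ring
  have e2 : ∫ p in Set.Ioi (0 : ℝ) ×ˢ Set.Ioo (-π) π, b p = 0 := by
    rw [Measure.volume_eq_prod, setIntegral_prod _ ib]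
    simp only [hb, integral_const_mul, integral_angular_eq_zero hφ, mul_zero, integral_zero]
  have e3 : ∫ p in Set.Ioi (0 : ℝ) ×ˢ Set.Ioo (-π) π, a p =
      ∫ θ in Set.Ioo (-π) π, φ (ρ • circleVec θ) := by
    rw [Measure.volume_eq_prod, ← Measure.prod_restrict, integral_prod_symm]
    · simp only [ha, integral_log_max_mul_radial hφ hρ hR hz]
    · rw [Measure.prod_restrict]; exact ia
  rw [e1, integral_add ia ib, e2, e3, add_zero]

theorem integral_lap_eq_zero (hφ : ContDiff ℝ (⊤ : ℕ∞) φ) (hsupp : HasCompactSupport φ) :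
    ∫ x, lap φ x = 0 := by
  obtain ⟨R, hR, hz⟩ := exists_radius_support hsupp 1
  have hR0 : 0 < R := one_pos.trans hR
  have h1 := integral_log_max_mul_lap hφ hsupp hR0
  have h2 : ∀ x, log (max ‖x‖ R) * lap φ x = log R * lap φ x := by
    intro x
    rcases le_total R ‖x‖ with h | h
    · simp [lap, iteratedFDeriv_two_apply, hz x h]
    · rw [max_eq_right h]
  have h3 : ∀ θ, φ (R • circleVec θ) = 0 := fun θ =>
    (hz _ (by rw [norm_smul_circleVec hR0.le])).1
  simp only [h2, h3, integral_const_mul, integral_zero] at h1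
  exact (mul_eq_zero.1 h1).resolve_left (log_pos hR).ne'

end Polar

theorem integrableOn_closedBall_of_le_rpow {f : R2 → ℝ} {A p : ℝ} (hp : -2 < p)
    (hf : AEStronglyMeasurable f) (h : ∀ᵐ x, ‖x‖ ≤ 1 → |f x| ≤ A * ‖x‖ ^ p) :
    IntegrableOn f (closedBall 0 1) := by
  have h1 : LocallyIntegrable (fun x : R2 => A * ‖x‖ ^ p) :=
    locallyIntegrable_of_norm_le_rpow (C := |A|) (α := -p) (by simp) (by simp; linarith)
      (.of_forall fun x => by
        rw [norm_mul, norm_eq_abs, norm_eq_abs, neg_neg,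
          abs_of_nonneg (rpow_nonneg (norm_nonneg x) p)])
      ((measurable_norm.pow_const p).const_mul A).aestronglyMeasurable
  refine (h1.integrableOn_isCompact (isCompact_closedBall 0 1)).mono' hf.restrict ?_
  filter_upwards [ae_restrict_of_ae h, ae_restrict_mem measurableSet_closedBall] with x hx hm
  exact hx (by simpa using hm)

theorem integrableOn_compl_ball_of_le_rpow {f : R2 → ℝ} {A p : ℝ} (hp : p < -2)
    (hf : AEStronglyMeasurable f) (h : ∀ᵐ x, 1 ≤ ‖x‖ → |f x| ≤ A * ‖x‖ ^ p) :
    IntegrableOn f (ball 0 1)ᶜ := by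
  have h1 : Integrable fun x : R2 => (Set.Ici (1 : ℝ)).indicator (fun r => r ^ p) ‖x‖ := by
    rw [integrable_fun_norm_addHaar volume (f := (Set.Ici (1 : ℝ)).indicator (fun r => r ^ p))]
    have h2 : IntegrableOn (fun y : ℝ => y ^ (p + 1)) (Set.Ici 1) :=
      (integrableOn_Ici_iff_integrableOn_Ioi (by simp)).2
        (integrableOn_Ioi_rpow_of_lt (by linarith) one_pos)
    refine ((integrable_indicator_iff measurableSet_Ici).2 h2).integrableOn.congr_fun
      (fun y (hy : 0 < y) => ?_) measurableSet_Ioi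
    by_cases h : 1 ≤ y
    · simp [h, rpow_add_one hy.ne', mul_comm]
    · simp [h]
  refine (h1.integrableOn.const_mul A).mono' hf.restrict ?_
  filter_upwards [ae_restrict_of_ae h, ae_restrict_mem measurableSet_ball.compl] with x hx hm
  have : 1 ≤ ‖x‖ := by simpa using hm
  simpa [this] using hx this

theorem integrable_of_integrableOn_closedBall {f : R2 → ℝ} (h1 : IntegrableOn f (closedBall 0 1))
    (h2 : IntegrableOn f (ball 0 1)ᶜ) : Integrable f := by
  rw [← integrableOn_univ]
  refine (h1.union h2).mono_set fun x _ => ?_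
  by_cases h : ‖x‖ ≤ 1
  · exact Or.inl (by simpa using h)
  · exact Or.inr (by simpa using (not_le.1 h).le)

theorem ae_ne_zero_R2 : ∀ᵐ x : R2, x ≠ 0 := by simp [ae_iff]

theorem exp_mul_log {r : ℝ} (hr : 0 < r) (s : ℝ) : exp (s * log r) = r ^ s := by
  rw [rpow_def_of_pos hr, mul_comm]

/-- The potential `V` weighted by `‖x‖ ^ (-2β)` outside the unit disc. -/
def weightedPotential (β : ℝ) (V : R2 → ℝ) (x : R2) : ℝ :=
  V x * exp (-(2 * β) * max (log ‖x‖) 0)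

section WeightedPotential

variable {β : ℝ} {V : R2 → ℝ}

theorem weightedPotential_of_norm_le_one {x : R2} (hx : ‖x‖ ≤ 1) :
    weightedPotential β V x = V x := by
  simp [weightedPotential, max_eq_right (log_nonpos (norm_nonneg x) hx)]

theorem weightedPotential_of_one_le_norm {x : R2} (hx : 1 ≤ ‖x‖) :
    weightedPotential β V x = V x * ‖x‖ ^ (-(2 * β)) := by
  rw [weightedPotential, max_eq_left (log_nonneg hx), exp_mul_log (one_pos.trans_le hx)]

theorem aestronglyMeasurable_weightedPotential (hV : AEStronglyMeasurable V) :
    AEStronglyMeasurable (weightedPotential β V) :=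
  hV.mul (Measurable.aestronglyMeasurable (by fun_prop))

theorem integrable_weightedPotential {C₀ C₂ l₀ l₂ : ℝ} (hβ : 0 < β) (hVloc : LocallyIntegrable V)
    (hl₀ : l₀ < 2 * β - 2) (hl₂ : l₂ < β - 2) (hC₀ : 0 < C₀) (hC₂ : 0 < C₂)
    (hb₀ : ∀ᵐ x : R2, 1 ≤ ‖x‖ → max (-V x) 0 ≤ C₀ * ‖x‖ ^ l₀)
    (hb₂ : ∀ᵐ x : R2, 1 ≤ ‖x‖ → max (V x) 0 ≤ C₂ * ‖x‖ ^ l₂) :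
    Integrable (weightedPotential β V) := by
  refine integrable_of_integrableOn_closedBall ?_ ?_
  · refine (hVloc.integrableOn_isCompact (isCompact_closedBall 0 1)).congr_fun (fun x hx => ?_)
      measurableSet_closedBall
    exact (weightedPotential_of_norm_le_one (by simpa using hx)).symm
  · refine integrableOn_compl_ball_of_le_rpow (A := C₀ + C₂) (p := max l₀ l₂ + -(2 * β)) ?_
      (aestronglyMeasurable_weightedPotential hVloc.aestronglyMeasurable) ?_
    · have : max l₀ l₂ < 2 * β - 2 := max_lt hl₀ (by linarith)
      linarith
    · filter_upwards [hb₀, hb₂] with x h0 h2 hx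
      have hpos : 0 < ‖x‖ := one_pos.trans_le hx
      rw [weightedPotential_of_one_le_norm hx, abs_mul, abs_of_nonneg (rpow_nonneg hpos.le _),
        rpow_add hpos, ← mul_assoc]
      gcongr
      have e0 := rpow_le_rpow_of_exponent_le hx (le_max_left l₀ l₂)
      have e2 := rpow_le_rpow_of_exponent_le hx (le_max_right l₀ l₂)
      have := mul_le_mul_of_nonneg_left e0 hC₀.le
      have := mul_le_mul_of_nonneg_left e2 hC₂.le
      have := h0 hx
      have := h2 hx
      have a1 := le_max_left (V x) 0
      have a2 := le_max_right (V x) 0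
      have a3 := le_max_left (-V x) 0
      have a4 := le_max_right (-V x) 0
      rw [add_mul]
      exact abs_le.2 ⟨by linarith, by linarith⟩

theorem exists_integrable_posPart_weightedPotential {C₁ C₂ l₁ l₂ : ℝ}
    (hVloc : LocallyIntegrable V) (hl₁ : β - 2 < l₁) (hl₂ : l₂ < β - 2)
    (hb₁ : ∀ᵐ x : R2, ‖x‖ ≤ 1 → max (V x) 0 ≤ C₁ * ‖x‖ ^ l₁)
    (hb₂ : ∀ᵐ x : R2, 1 ≤ ‖x‖ → max (V x) 0 ≤ C₂ * ‖x‖ ^ l₂) :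
    ∃ δ, β < δ ∧
      Integrable fun x => max (weightedPotential β V x) 0 * exp (δ * |log ‖x‖|) := by
  obtain ⟨ε, hε, hε'⟩ := exists_between (lt_min (sub_pos.2 hl₁) (sub_pos.2 hl₂))
  obtain ⟨h1, h2⟩ := lt_min_iff.1 hε'
  have hmeas : AEStronglyMeasurable
      fun x => max (weightedPotential β V x) 0 * exp ((β + ε) * |log ‖x‖|) :=
    ((aestronglyMeasurable_weightedPotential hVloc.aestronglyMeasurable).sup
      aestronglyMeasurable_const).mul (Measurable.aestronglyMeasurable (by fun_prop))
  have habs : ∀ x, |max (weightedPotential β V x) 0 * exp ((β + ε) * |log ‖x‖|)| =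
      max (weightedPotential β V x) 0 * exp ((β + ε) * |log ‖x‖|) := fun x =>
    abs_of_nonneg (mul_nonneg (le_max_right _ _) (exp_pos _).le)
  refine ⟨β + ε, by linarith, integrable_of_integrableOn_closedBall
    (integrableOn_closedBall_of_le_rpow (A := C₁) (p := l₁ + -(β + ε)) (by linarith) hmeas ?_)
    (integrableOn_compl_ball_of_le_rpow (A := C₂) (p := l₂ + -(2 * β) + (β + ε)) (by linarith)
      hmeas ?_)⟩
  · filter_upwards [hb₁, ae_ne_zero_R2] with x h hx0 hx
    have hpos : 0 < ‖x‖ := norm_pos_iff.2 hx0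
    rw [habs, weightedPotential_of_norm_le_one hx, abs_of_nonpos (log_nonpos hpos.le hx),
      mul_neg, ← neg_mul, exp_mul_log hpos, rpow_add hpos l₁, ← mul_assoc]
    gcongr
    exact h hx
  · filter_upwards [hb₂] with x h hx
    have hpos : 0 < ‖x‖ := one_pos.trans_le hx
    rw [habs, weightedPotential_of_one_le_norm hx, abs_of_nonneg (log_nonneg hx),
      exp_mul_log hpos, rpow_add hpos _ (β + ε), rpow_add hpos l₂, ← mul_assoc, ← mul_assoc]
    gcongr
    have h3 := max_mul_of_nonneg (V x) 0 (rpow_nonneg hpos.le (-(2 * β)))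
    rw [zero_mul] at h3
    rw [← h3]
    gcongr
    exact h hx

end WeightedPotential

/-- The tent function supported on `[a, b]`. -/
def tent (a b t : ℝ) : ℝ := max a t + max b t - 2 * max ((a + b) / 2) t

section Tent

variable {a b t : ℝ}

theorem tent_eq_zero (hab : a ≤ b) (ht : t ≤ a ∨ b ≤ t) : tent a b t = 0 := by
  rcases ht with h | h
  · rw [tent, max_eq_left h, max_eq_left (by linarith), max_eq_left (by linarith)]; ring
  · rw [tent, max_eq_right (by linarith), max_eq_right h, max_eq_right (by linarith)]; ring

theorem tent_pos (h1 : a < t) (h2 : t < b) : 0 < tent a b t := by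
  rw [tent, max_eq_right h1.le, max_eq_left h2.le]
  rcases le_total t ((a + b) / 2) with h | h
  · rw [max_eq_left h]; linarith
  · rw [max_eq_right h]; linarith

theorem tent_nonneg (hab : a ≤ b) : 0 ≤ tent a b t := by
  by_cases h : a < t ∧ t < b
  · exact (tent_pos h.1 h.2).le
  · rw [tent_eq_zero hab]
    rw [not_and_or, not_lt, not_lt] at h
    exact h

theorem tent_le (hab : a ≤ b) : tent a b t ≤ b - a := by
  have h1 : max b t ≤ max ((a + b) / 2) t + (b - a) / 2 :=
    max_le (by linarith [le_max_left ((a + b) / 2) t]) (by linarith [le_max_right ((a + b) / 2) t])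
  have h2 : max a t ≤ max ((a + b) / 2) t := max_le_max_right t (by linarith)
  rw [tent]
  linarith

theorem exists_inner_signedIndicator_eq_tent (a b : ℝ) :
    ∃ (g : Lp ℝ 2 (volume : Measure ℝ)) (κ : ℝ),
      ∀ t, inner ℝ (signedIndicator t) g = κ + tent a b t := by
  refine ⟨(2 : ℝ) • signedIndicator ((a + b) / 2) - signedIndicator a - signedIndicator b,
    2 * max ((a + b) / 2) 0 - max a 0 - max b 0, fun t => ?_⟩
  rw [inner_sub_right, inner_sub_right, inner_smul_right, inner_signedIndicator_signedIndicator,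
    inner_signedIndicator_signedIndicator, inner_signedIndicator_signedIndicator, tent]
  ring

end Tent

theorem exists_integral_mul_exp_pos {X : Type*} [MeasurableSpace X] {μ : Measure X} {K T : X → ℝ}
    {M : ℝ} (hK : Integrable K μ) (hT : AEStronglyMeasurable T μ) (hT0 : ∀ x, 0 ≤ T x)
    (hTM : ∀ x, T x ≤ M) (hKT : ∀ᵐ x ∂μ, 0 ≤ K x * T x) (hpos : 0 < ∫ x, K x * T x ∂μ) :
    ∃ N : ℕ, Integrable (fun x => K x * exp (N * T x)) μ ∧ 0 < ∫ x, K x * exp (N * T x) ∂μ := by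
  obtain ⟨N, hN⟩ := exists_nat_gt (-(∫ x, K x ∂μ) / ∫ x, K x * T x ∂μ)
  rw [div_lt_iff₀ hpos] at hN
  have h1 : Integrable (fun x => K x * exp (N * T x)) μ := by
    refine hK.mul_bdd (c := exp (N * M)) (by fun_prop) (.of_forall fun x => ?_)
    rw [norm_of_nonneg (exp_pos _).le]
    gcongr
    exact hTM x
  have h2 : Integrable (fun x => K x * T x) μ :=
    hK.mul_bdd (c := M) hT (.of_forall fun x => by rw [norm_of_nonneg (hT0 x)]; exact hTM x)
  refine ⟨N, h1, ?_⟩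
  have h3 : ∫ x, (K x + N * (K x * T x)) ∂μ ≤ ∫ x, K x * exp (N * T x) ∂μ := by
    refine integral_mono_ae (hK.add (h2.const_mul _)) h1 ?_
    filter_upwards [hKT] with x hx
    rcases (hT0 x).eq_or_lt with h | h
    · simp [← h]
    · have hKx : 0 ≤ K x := nonneg_of_mul_nonneg_left hx h
      have := mul_le_mul_of_nonneg_left (add_one_le_exp (N * T x)) hKx
      linarith
  rw [integral_add hK (h2.const_mul _), integral_const_mul] at h3
  linarith

theorem exists_integral_weightedPotential_pos {β : ℝ} {V : R2 → ℝ} {C R₁ R₂ : ℝ} (hC : 0 < C)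
    (hR₁ : 0 < R₁) (hR : R₁ < R₂) (hK : Integrable (weightedPotential β V))
    (hVC : ∀ᵐ x : R2, R₁ < ‖x‖ ∧ ‖x‖ < R₂ → C ≤ V x) :
    ∃ f, Integrable (fun x : R2 => weightedPotential β V x *
        exp (inner ℝ (signedIndicator (log ‖x‖)) f)) ∧
      0 < ∫ x : R2, weightedPotential β V x * exp (inner ℝ (signedIndicator (log ‖x‖)) f) := by
  have hab : log R₁ ≤ log R₂ := log_le_log hR₁ hR.le
  have hmeas : AEStronglyMeasurable fun x : R2 => tent (log R₁) (log R₂) (log ‖x‖) :=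
    Measurable.aestronglyMeasurable (by unfold tent; fun_prop)
  have hzero : ∀ x : R2, x ≠ 0 → ¬ (R₁ < ‖x‖ ∧ ‖x‖ < R₂) →
      tent (log R₁) (log R₂) (log ‖x‖) = 0 := fun x hx h => by
    have hpos := norm_pos_iff.2 hx
    rw [not_and_or, not_lt, not_lt] at h
    exact tent_eq_zero hab (h.imp (log_le_log hpos) (log_le_log (hR₁.trans hR)))
  have hnn : ∀ᵐ x : R2, 0 ≤ weightedPotential β V x * tent (log R₁) (log R₂) (log ‖x‖) := by
    filter_upwards [hVC, ae_ne_zero_R2] with x hx hx0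
    by_cases h : R₁ < ‖x‖ ∧ ‖x‖ < R₂
    · exact mul_nonneg (mul_nonneg (hC.le.trans (hx h)) (exp_pos _).le) (tent_nonneg hab)
    · rw [hzero x hx0 h, mul_zero]
  have hint : Integrable fun x => weightedPotential β V x * tent (log R₁) (log R₂) (log ‖x‖) :=
    hK.mul_bdd (c := log R₂ - log R₁) hmeas
      (.of_forall fun x => by rw [norm_of_nonneg (tent_nonneg hab)]; exact tent_le hab)
  have hpos : 0 < ∫ x, weightedPotential β V x * tent (log R₁) (log R₂) (log ‖x‖) := by
    rw [integral_pos_iff_support_of_nonneg_ae hnn hint]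
    have hopen : IsOpen {x : R2 | R₁ < ‖x‖ ∧ ‖x‖ < R₂} :=
      (isOpen_lt continuous_const continuous_norm).inter
        (isOpen_lt continuous_norm continuous_const)
    have hne : {x : R2 | R₁ < ‖x‖ ∧ ‖x‖ < R₂}.Nonempty := by
      refine ⟨((R₁ + R₂) / 2) • circleVec 0, ?_⟩
      rw [Set.mem_ofPred_eq, norm_smul_circleVec (by linarith)]
      constructor <;> linarith
    refine (hopen.measure_pos volume hne).trans_le (measure_mono_ae ?_)
    filter_upwards [hVC] with x hx (h : R₁ < ‖x‖ ∧ ‖x‖ < R₂)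
    exact (mul_pos (mul_pos (hC.trans_le (hx h)) (exp_pos _))
      (tent_pos (log_lt_log hR₁ h.1) (log_lt_log (hR₁.trans h.1) h.2))).ne'
  obtain ⟨N, h1, h2⟩ := exists_integral_mul_exp_pos hK hmeas (fun x => tent_nonneg hab)
    (fun x => tent_le hab) hnn hpos
  obtain ⟨g, κ, hg⟩ := exists_inner_signedIndicator_eq_tent (log R₁) (log R₂)
  have heq : ∀ x : R2, weightedPotential β V x *
      exp (inner ℝ (signedIndicator (log ‖x‖)) ((N : ℝ) • g)) =
        exp (N * κ) * (weightedPotential β V x *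
          exp (N * tent (log R₁) (log R₂) (log ‖x‖))) := fun x => by
    rw [inner_smul_right, hg, mul_add, exp_add]
    ring
  refine ⟨(N : ℝ) • g, ?_, ?_⟩
  · simp_rw [heq]
    exact h1.const_mul _
  · simp_rw [heq]
    rw [integral_const_mul]
    exact mul_pos (exp_pos _) h2

section MaxPotential

variable {X : Type*} [MeasurableSpace X] {μ : Measure X} {ρ τ : X → ℝ}

theorem abs_max_sub_max_zero_le (b t : ℝ) : |max b t - max 0 t| ≤ |b| := by
  simpa using abs_max_sub_max_le_abs b 0 t

theorem integrable_mul_max_sub_max (hρ : Integrable ρ μ) (hτ : Measurable τ) (b : ℝ) :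
    Integrable (fun y => ρ y * (max b (τ y) - max 0 (τ y))) μ :=
  hρ.mul_bdd (c := |b|) (Measurable.aestronglyMeasurable (by fun_prop))
    (.of_forall fun y => abs_max_sub_max_zero_le b (τ y))

theorem hasDerivAt_max_const {b t : ℝ} (h : t ≠ b) :
    HasDerivAt (fun s => max s t) (if t < b then 1 else 0) b := by
  rcases lt_or_gt_of_ne h with h | h
  · rw [if_pos h]
    exact (hasDerivAt_id b).congr_of_eventuallyEq
      ((eventually_gt_nhds h).mono fun s hs => max_eq_left hs.le)
  · rw [if_neg h.not_gt]
    exact (hasDerivAt_const b t).congr_of_eventuallyEq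
      ((eventually_lt_nhds h).mono fun s hs => max_eq_right hs.le)

theorem hasDerivAt_integral_mul_max (hρ : Integrable ρ μ) (hτ : Measurable τ) {b : ℝ}
    (hb : ∀ᵐ y ∂μ, τ y ≠ b) :
    HasDerivAt (fun s => ∫ y, ρ y * (max s (τ y) - max 0 (τ y)) ∂μ)
      (∫ y, ρ y * (if τ y < b then 1 else 0) ∂μ) b := by
  refine (hasDerivAt_integral_of_dominated_loc_of_lip (bound := fun y => |ρ y|) (s := Set.univ)
    univ_mem (.of_forall fun s => (integrable_mul_max_sub_max hρ hτ s).aestronglyMeasurable)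
    (integrable_mul_max_sub_max hρ hτ b) ?_ ?_ hρ.abs ?_).2
  · exact hρ.aestronglyMeasurable.mul (Measurable.aestronglyMeasurable
      (Measurable.ite (measurableSet_lt hτ measurable_const) measurable_const measurable_const))
  · refine .of_forall fun y => LipschitzWith.lipschitzOnWith (LipschitzWith.of_dist_le_mul
      fun s t => ?_)
    rw [Real.dist_eq, Real.dist_eq, ← mul_sub, abs_mul, coe_nnabs, abs_abs,
      sub_sub_sub_cancel_right]
    refine mul_le_mul_of_nonneg_left ?_ (abs_nonneg _)
    exact abs_max_sub_max_le_abs s t (τ y)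
  · filter_upwards [hb] with y hy
    exact ((hasDerivAt_max_const hy).sub_const _).const_mul _

theorem continuous_integral_mul_ite_lt (hρ : Integrable ρ μ) (hτ : Measurable τ)
    (hb : ∀ b, ∀ᵐ y ∂μ, τ y ≠ b) :
    Continuous fun b => ∫ y, ρ y * (if τ y < b then 1 else 0) ∂μ := by
  refine continuous_iff_continuousAt.2 fun b => continuousAt_of_dominated
    (bound := fun y => |ρ y|) (.of_forall fun s => ?_) (.of_forall fun s => .of_forall fun y => ?_)
    hρ.abs ?_
  · exact hρ.aestronglyMeasurable.mul (Measurable.aestronglyMeasurable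
      (Measurable.ite (measurableSet_lt hτ measurable_const) measurable_const measurable_const))
  · by_cases h : τ y < s <;> simp [h]
  · filter_upwards [hb b] with y hy
    refine continuousAt_const.mul ?_
    rcases lt_or_gt_of_ne hy with h | h
    · exact continuousAt_const.congr ((eventually_gt_nhds h).mono fun s hs => (if_pos hs).symm)
    · exact continuousAt_const.congr
        ((eventually_lt_nhds h).mono fun s hs => (if_neg (not_lt.2 hs.le)).symm)

end MaxPotential

theorem ae_log_norm_ne (b : ℝ) : ∀ᵐ y : R2, log ‖y‖ ≠ b := by
  have h : ∀ᵐ y : R2, y ∉ sphere (0 : R2) (exp b) :=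
    measure_eq_zero_iff_ae_notMem.1 (Measure.addHaar_sphere volume 0 (exp b))
  filter_upwards [h, ae_ne_zero_R2] with y hy hy0 hb
  refine hy ?_
  rw [mem_sphere_zero_iff_norm, ← hb, exp_log (norm_pos_iff.2 hy0)]

theorem measurable_log_norm : Measurable fun y : R2 => log ‖y‖ := by fun_prop

theorem exists_radial_profile {β : ℝ} {V : R2 → ℝ} {C R₁ R₂ δ : ℝ} (hβ : 0 < β) (hC : 0 < C)
    (hR₁ : 0 < R₁) (hR : R₁ < R₂) (hK : Integrable (weightedPotential β V))
    (hVC : ∀ᵐ x : R2, R₁ < ‖x‖ ∧ ‖x‖ < R₂ → C ≤ V x) (hδ : β < δ)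
    (hA : Integrable fun x => max (weightedPotential β V x) 0 * exp (δ * |log ‖x‖|)) :
    ∃ (u : ℝ → ℝ) (c : ℝ), Integrable (fun x : R2 => V x * exp (u (log ‖x‖))) ∧
      ∫ x : R2, V x * exp (u (log ‖x‖)) = 1 ∧
      (∀ b, u b = c - 2 * β * ∫ y : R2, V y * exp (u (log ‖y‖)) *
        (max b (log ‖y‖) - max 0 (log ‖y‖))) ∧
      Integrable fun b => (deriv u b + 2 * β * if 0 < b then 1 else 0) ^ 2 := by
  have : Fact ((2 : ENNReal) ≠ ⊤) := ⟨by norm_num⟩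
  have he : ∀ f, AEStronglyMeasurable fun x : R2 => inner ℝ (signedIndicator (log ‖x‖)) f :=
    fun f => ((continuous_inner_signedIndicator f).measurable.comp
      measurable_log_norm).aestronglyMeasurable
  obtain ⟨f, hf, hpos, hmax⟩ := exists_gibbs_maximizer
    (e := fun x : R2 => signedIndicator (log ‖x‖)) hβ hδ hK.aestronglyMeasurable he (by simpa only [norm_signedIndicator_sq] using hA)
    (exists_integral_weightedPotential_pos hC hR₁ hR hK hVC)
  set Z := ∫ x : R2, weightedPotential β V x * exp (inner ℝ (signedIndicator (log ‖x‖)) f) with hZ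
  set u : ℝ → ℝ := fun t => -(2 * β) * max t 0 + inner ℝ (signedIndicator t) f - log Z with hu
  have hρ : ∀ x : R2, V x * exp (u (log ‖x‖)) =
      weightedPotential β V x * exp (inner ℝ (signedIndicator (log ‖x‖)) f) / Z := fun x => by
    rw [hu, weightedPotential]
    dsimp only
    rw [exp_sub, exp_add, exp_log hpos]
    ring
  have hint : Integrable fun x : R2 => V x * exp (u (log ‖x‖)) := by
    simp_rw [hρ]
    exact hf.div_const Z
  have hone : ∫ x : R2, V x * exp (u (log ‖x‖)) = 1 := by
    simp_rw [hρ]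
    rw [integral_div, ← hZ, div_self hpos.ne']
  have hueq : ∀ b, u b = -log Z - 2 * β * ∫ y : R2, V y * exp (u (log ‖y‖)) *
      (max b (log ‖y‖) - max 0 (log ‖y‖)) := fun b => by
    have h1 := gibbs_euler_lagrange hβ he (g := signedIndicator b) (M := |b|) hf hpos hmax
      (fun x => by
        rw [inner_signedIndicator_signedIndicator]
        grind)
    have h2 : ∀ y : R2, weightedPotential β V y * exp (inner ℝ (signedIndicator (log ‖y‖)) f) *
        inner ℝ (signedIndicator (log ‖y‖)) (signedIndicator b) / Z =
        max b 0 * (V y * exp (u (log ‖y‖))) -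
          V y * exp (u (log ‖y‖)) * (max b (log ‖y‖) - max 0 (log ‖y‖)) := fun y => by
      rw [inner_signedIndicator_signedIndicator, hρ, max_comm 0]
      ring
    rw [← hZ, ← integral_div] at h1
    simp_rw [h2] at h1
    rw [integral_sub (hint.const_mul _) (integrable_mul_max_sub_max hint measurable_log_norm b),
      integral_const_mul, hone, real_inner_comm] at h1
    rw [hu]
    dsimp only
    rw [h1]
    ring
  refine ⟨u, -log Z, hint, hone, hueq, ?_⟩
  have hderiv : ∀ b, DifferentiableAt ℝ u b := fun b => by
    rw [funext hueq]
    exact (((hasDerivAt_integral_mul_max hint measurable_log_norm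
      (ae_log_norm_ne b)).const_mul (2 * β)).const_sub _).differentiableAt
  refine integrable_sq_of_hasDerivAt_inner_signedIndicator (f := f) fun b hb => ?_
  have h1 : (fun t => inner ℝ (signedIndicator t) f) =
      fun t => u t + 2 * β * max t 0 + log Z := by
    funext t
    rw [hu]
    ring
  rw [h1]
  exact ((hderiv b).hasDerivAt.add ((hasDerivAt_max_const hb.symm).const_mul (2 * β))).add_const _

theorem locallyIntegrable_log_norm : LocallyIntegrable fun x : R2 => log ‖x‖ := by
  have h1 : LocallyIntegrable fun x : R2 => ‖x‖ ^ (-1 : ℝ) :=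
    locallyIntegrable_of_norm_le_rpow (C := 1) (α := 1) (by simp) (by simp)
      (.of_forall fun x => by rw [one_mul, norm_of_nonneg (rpow_nonneg (norm_nonneg x) _)])
      (measurable_norm.pow_const _).aestronglyMeasurable
  refine (continuous_norm.locallyIntegrable.add h1).mono measurable_log_norm.aestronglyMeasurable ?_
  filter_upwards [ae_ne_zero_R2] with x hx
  have hpos := norm_pos_iff.2 hx
  have h2 := log_le_sub_one_of_pos hpos
  have h3 := one_sub_inv_le_log_of_pos hpos
  have h4 : 0 < ‖x‖⁻¹ := inv_pos.2 hpos
  rw [Pi.add_apply, rpow_neg_one, norm_eq_abs, norm_of_nonneg (by positivity)]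
  exact abs_le.2 ⟨by linarith, by linarith⟩

theorem integral_mul_circle_average {ρ φ : R2 → ℝ} (hρ : Integrable ρ) (hrad : RadSym ρ)
    (hφ : Continuous φ) (hsupp : HasCompactSupport φ) :
    ∫ y, ρ y * ∫ θ in Set.Ioo (-π) π, φ (‖y‖ • circleVec θ) = 2 * π * ∫ y, ρ y * φ y := by
  set g : ℝ → ℝ := fun r => ρ (r • circleVec 0) with hg
  have hgρ : ∀ x, ρ x = g ‖x‖ := fun x =>
    hrad _ _ (norm_smul_circleVec (norm_nonneg x) 0).symm
  have h1 : IntegrableOn (fun r : ℝ => r * g r) (Set.Ioi 0) := by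
    have h := (integrable_fun_norm_addHaar (volume : Measure R2) (f := g)).1
      (by simpa only [← hgρ] using hρ)
    simpa using h
  obtain ⟨B, hB⟩ := hsupp.exists_bound_of_continuous hφ
  have h2 : IntegrableOn (fun p : ℝ × ℝ => p.1 * g p.1 * φ (p.1 • circleVec p.2))
      (Set.Ioi 0 ×ˢ Set.Ioo (-π) π) := by
    have h3 : Integrable (fun p : ℝ × ℝ => p.1 * g p.1)
        ((volume.restrict (Set.Ioi 0)).prod (volume.restrict (Set.Ioo (-π) π))) := h1.comp_fst _
    rw [Measure.prod_restrict] at h3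
    refine h3.mul_bdd (c := B) (Continuous.aestronglyMeasurable ?_) (.of_forall fun p => hB _)
    exact hφ.comp (continuous_fst.smul (continuous_circleVec.comp continuous_snd))
  have hmeas : MeasurableSet (Set.Ioi (0 : ℝ) ×ˢ Set.Ioo (-π) π) :=
    measurableSet_Ioi.prod measurableSet_Ioo
  rw [integral_R2_eq_polar, integral_R2_eq_polar]
  have h4 : ∫ p in Set.Ioi (0 : ℝ) ×ˢ Set.Ioo (-π) π, p.1 * (ρ (p.1 • circleVec p.2) *
      φ (p.1 • circleVec p.2)) =
      ∫ r in Set.Ioi (0 : ℝ), r * g r * ∫ θ in Set.Ioo (-π) π, φ (r • circleVec θ) := by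
    simp_rw [← integral_const_mul]
    rw [← setIntegral_prod (μ := volume) (ν := volume) _ h2]
    refine setIntegral_congr_fun hmeas fun p hp => ?_
    rw [hgρ, norm_smul_circleVec (le_of_lt hp.1), mul_assoc]
  have h5 : ∫ p in Set.Ioi (0 : ℝ) ×ˢ Set.Ioo (-π) π, p.1 * (ρ (p.1 • circleVec p.2) *
      ∫ θ in Set.Ioo (-π) π, φ (‖p.1 • circleVec p.2‖ • circleVec θ)) =
      ∫ p in Set.Ioi (0 : ℝ) ×ˢ Set.Ioo (-π) π, (p.1 * g p.1 *
        ∫ θ in Set.Ioo (-π) π, φ (p.1 • circleVec θ)) * (1 : ℝ) := by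
    refine setIntegral_congr_fun hmeas fun p hp => ?_
    rw [hgρ, norm_smul_circleVec (le_of_lt hp.1), mul_one, mul_assoc]
  rw [h4, h5]
  have h6 := setIntegral_prod_mul (μ := volume) (ν := volume)
    (fun r : ℝ => r * g r * ∫ θ in Set.Ioo (-π) π, φ (r • circleVec θ)) (fun _ : ℝ => (1 : ℝ))
    (Set.Ioi 0) (Set.Ioo (-π) π)
  rw [← Measure.volume_eq_prod] at h6
  rw [h6]
  simp [pi_pos.le]
  ring

theorem continuous_lap {φ : R2 → ℝ} (hφ : ContDiff ℝ (⊤ : ℕ∞) φ) : Continuous (lap φ) := by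
  have h1 := continuous_fderiv_fderiv hφ
  unfold lap
  simp only [iteratedFDeriv_two_apply]
  fun_prop

theorem hasCompactSupport_lap {φ : R2 → ℝ} (hsupp : HasCompactSupport φ) :
    HasCompactSupport (lap φ) := by
  have h1 := (hsupp.fderiv (𝕜 := ℝ)).fderiv (𝕜 := ℝ)
  refine h1.mono fun x hx h => hx ?_
  simp [lap, iteratedFDeriv_two_apply, h]

theorem integral_max_log_mul_lap {φ : R2 → ℝ} (hφ : ContDiff ℝ (⊤ : ℕ∞) φ)
    (hsupp : HasCompactSupport φ) {y : R2} (hy : y ≠ 0) :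
    ∫ x : R2, (max (log ‖x‖) (log ‖y‖) - max 0 (log ‖y‖)) * lap φ x =
      ∫ θ in Set.Ioo (-π) π, φ (‖y‖ • circleVec θ) := by
  have hpos := norm_pos_iff.2 hy
  rw [← integral_log_max_mul_lap hφ hsupp hpos]
  have hlap := continuous_lap hφ
  have hlsupp := hasCompactSupport_lap hsupp
  have h1 : Integrable fun x => log (max ‖x‖ ‖y‖) * lap φ x :=
    (((continuous_log_max hpos).comp continuous_norm).mul hlap).integrable_of_hasCompactSupport
      hlsupp.mul_left
  have h2 : ∫ x : R2, (max (log ‖x‖) (log ‖y‖) - max 0 (log ‖y‖)) * lap φ x =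
      ∫ x : R2, (log (max ‖x‖ ‖y‖) * lap φ x - max 0 (log ‖y‖) * lap φ x) := by
    refine integral_congr_ae ?_
    filter_upwards [ae_ne_zero_R2] with x hx
    have hx' := norm_pos_iff.2 hx
    have : max (log ‖x‖) (log ‖y‖) = log (max ‖x‖ ‖y‖) := by
      rcases le_total ‖x‖ ‖y‖ with h | h
      · rw [max_eq_right h, max_eq_right (log_le_log hx' h)]
      · rw [max_eq_left h, max_eq_left (log_le_log hpos h)]
    rw [this, sub_mul]
  rw [h2, integral_sub h1 ((hlap.integrable_of_hasCompactSupport hlsupp).const_mul _),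
    integral_const_mul, integral_lap_eq_zero hφ hsupp, mul_zero, sub_zero]

theorem integral_logPotential_mul_lap {ρ φ : R2 → ℝ} (hρ : Integrable ρ) (hrad : RadSym ρ)
    (hφ : ContDiff ℝ (⊤ : ℕ∞) φ) (hsupp : HasCompactSupport φ) :
    ∫ x : R2, (∫ y : R2, ρ y * (max (log ‖x‖) (log ‖y‖) - max 0 (log ‖y‖))) * lap φ x =
      2 * π * ∫ y, ρ y * φ y := by
  have hint : Integrable fun x : R2 => log ‖x‖ * lap φ x :=
    locallyIntegrable_log_norm.integrable_smul_right_of_hasCompactSupport (continuous_lap hφ)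
      (hasCompactSupport_lap hsupp)
  have hprod : Integrable (fun p : R2 × R2 => ρ p.2 *
      (max (log ‖p.1‖) (log ‖p.2‖) - max 0 (log ‖p.2‖)) * lap φ p.1)
      (volume.prod volume) := by
    refine (hint.mul_prod hρ).mono ?_ (.of_forall fun p => ?_)
    · refine (hρ.aestronglyMeasurable.comp_snd.mul
        (Measurable.aestronglyMeasurable (by fun_prop))).mul
        ((continuous_lap hφ).comp continuous_fst).aestronglyMeasurable
    · simp only [norm_mul, norm_eq_abs]
      calc |ρ p.2| * |max (log ‖p.1‖) (log ‖p.2‖) - max 0 (log ‖p.2‖)| * |lap φ p.1|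
          ≤ |ρ p.2| * |log ‖p.1‖| * |lap φ p.1| := by
            refine mul_le_mul_of_nonneg_right (mul_le_mul_of_nonneg_left ?_ (abs_nonneg _))
              (abs_nonneg _)
            exact abs_max_sub_max_zero_le _ _
        _ = |log ‖p.1‖| * |lap φ p.1| * |ρ p.2| := by ring
  simp_rw [← integral_mul_const]
  rw [integral_integral_swap hprod, ← integral_mul_circle_average hρ hrad hφ.continuous hsupp]
  refine integral_congr_ae ?_
  filter_upwards [ae_ne_zero_R2] with y hy
  rw [← integral_max_log_mul_lap hφ hsupp hy, ← integral_const_mul]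
  simp only [mul_assoc]

theorem norm_gradient_comp_log_norm_le {u : ℝ → ℝ} (hu : ContDiff ℝ 1 u) {x : R2} (hx : x ≠ 0) :
    ‖gradient (fun x : R2 => u (log ‖x‖)) x‖ ≤ |deriv u (log ‖x‖)| * ‖x‖⁻¹ := by
  have h1 : HasFDerivAt (fun x : R2 => ‖x‖) (fderiv ℝ (fun x : R2 => ‖x‖) x) x :=
    ((contDiffAt_norm ℝ hx (n := 1)).differentiableAt (by simp)).hasFDerivAt
  have h2 := ((hu.differentiable (by simp)) (log ‖x‖)).hasDerivAt.comp_hasFDerivAt x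
    (h1.log (norm_ne_zero_iff.2 hx))
  have h3 : ‖fderiv ℝ (fun x : R2 => ‖x‖) x‖ ≤ 1 := by
    simpa using norm_fderiv_le_of_lipschitz ℝ (lipschitzWith_one_norm (E := R2)) (x₀ := x)
  have h4 : fderiv ℝ (fun x : R2 => u (log ‖x‖)) x = _ := h2.fderiv
  rw [gradient, LinearIsometryEquiv.norm_map, h4, norm_smul, norm_smul, norm_eq_abs, norm_inv,
    norm_norm]
  exact mul_le_mul_of_nonneg_left (mul_le_of_le_one_right (by positivity) h3) (abs_nonneg _)

theorem integrableOn_norm_gradient_sq {u : ℝ → ℝ} (hu : ContDiff ℝ 1 u)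
    (hint : ∀ L, IntegrableOn (fun t => deriv u t ^ 2) (Set.Iio L)) {R : ℝ} (hR : 0 < R) :
    IntegrableOn (fun x : R2 => ‖gradient (fun x : R2 => u (log ‖x‖)) x‖ ^ 2) (ball 0 R) := by
  have himage : exp '' Set.Iio (log R) = Set.Ioo 0 R := by
    ext y
    constructor
    · rintro ⟨t, ht, rfl⟩
      exact ⟨exp_pos t, (lt_log_iff_exp_lt hR).1 ht⟩
    · rintro ⟨h0, h1⟩
      exact ⟨log y, log_lt_log h0 h1, exp_log h0⟩
  have h1 : IntegrableOn (fun y : ℝ => y * (deriv u (log y) * y⁻¹) ^ 2) (Set.Ioo 0 R) := by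
    rw [← himage, integrableOn_image_iff_integrableOn_abs_deriv_smul measurableSet_Iio
      (fun t _ => (hasDerivAt_exp t).hasDerivWithinAt) exp_injective.injOn]
    refine (hint (log R)).congr_fun (fun t _ => ?_) measurableSet_Iio
    have := exp_ne_zero t
    simp only [log_exp, abs_exp, smul_eq_mul]
    field_simp
  have h2 : IntegrableOn (fun x : R2 => (deriv u (log ‖x‖) * ‖x‖⁻¹) ^ 2) (ball 0 R) := by
    rw [integrableOn_fun_norm_addHaar volume (f := fun y => (deriv u (log y) * y⁻¹) ^ 2)]
    simpa using h1
  refine h2.mono' ?_ ?_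
  · simp only [gradient, LinearIsometryEquiv.norm_map]
    exact ((measurable_fderiv ℝ _).norm.pow_const 2).aestronglyMeasurable
  · filter_upwards [ae_restrict_of_ae ae_ne_zero_R2] with x hx
    rw [norm_of_nonneg (sq_nonneg _), ← sq_abs (deriv u _ * _), abs_mul, abs_inv, abs_norm]
    gcongr
    exact norm_gradient_comp_log_norm_le hu hx

theorem integrableOn_Iio_deriv_sq {u : ℝ → ℝ} {β : ℝ} (hu : ContDiff ℝ 1 u)
    (h : Integrable fun b => (deriv u b + 2 * β * if 0 < b then 1 else 0) ^ 2) (L : ℝ) :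
    IntegrableOn (fun t => deriv u t ^ 2) (Set.Iio L) := by
  have h1 : IntegrableOn (fun t => deriv u t ^ 2) (Set.Iic 0) :=
    h.integrableOn.congr_fun (fun t ht => by simp [not_lt.2 (Set.mem_Iic.1 ht)]) measurableSet_Iic
  have h2 : IntegrableOn (fun t => deriv u t ^ 2) (Set.Icc 0 L) :=
    ((hu.continuous_deriv le_rfl).pow 2).continuousOn.integrableOn_compact isCompact_Icc
  refine (h1.union h2).mono_set fun t (ht : t < L) => ?_
  rcases le_total t 0 with h | h
  · exact Or.inl h
  · exact Or.inr ⟨h, ht.le⟩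

theorem isWeakSol_of_eq_logPotential {ρ ψ : R2 → ℝ} {β c : ℝ} (hρ : Integrable ρ)
    (hrad : RadSym ρ) (hψloc : LocallyIntegrable ψ)
    (hψ : ∀ x, ψ x = c - 2 * β * ∫ y : R2, ρ y * (max (log ‖x‖) (log ‖y‖) - max 0 (log ‖y‖))) :
    IsWeakSol ψ fun x => 4 * π * β * ρ x := by
  intro φ hφ hsupp
  have h1 : Integrable fun x => ψ x * lap φ x :=
    hψloc.integrable_smul_right_of_hasCompactSupport (continuous_lap hφ)
      (hasCompactSupport_lap hsupp)
  have h2 : Integrable (lap φ) :=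
    (continuous_lap hφ).integrable_of_hasCompactSupport (hasCompactSupport_lap hsupp)
  have h3 : ∫ x, (ψ x * lap φ x - c * lap φ x) = -(2 * β) * (2 * π * ∫ y, ρ y * φ y) := by
    rw [← integral_logPotential_mul_lap hρ hrad hφ hsupp, ← integral_const_mul]
    refine integral_congr_ae (.of_forall fun x => ?_)
    dsimp only
    rw [hψ]
    ring
  rw [integral_sub h1 (h2.const_mul c), integral_const_mul, integral_lap_eq_zero hφ hsupp] at h3
  simp_rw [mul_assoc (4 * π * β)]
  rw [integral_const_mul]
  linarith

/-- Corollary 1.6: existence of a radially symmetric solution under power-law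
bounds on V⁻ and V⁺. -/
theorem existence_power_law (β : ℝ) (hβ : 0 < β) (V : R2 → ℝ)
    (hVloc : LocallyIntegrable V) (hVrad : RadSym V)
    (C R₁ R₂ : ℝ) (hC : 0 < C) (hR₁ : 0 < R₁) (hR : R₁ < R₂)
    (hVC : ∀ᵐ x : R2, R₁ < ‖x‖ ∧ ‖x‖ < R₂ → C ≤ V x)
    (C₀ C₁ C₂ : ℝ) (hC₀ : 0 < C₀) (hC₁ : 0 < C₁) (hC₂ : 0 < C₂)
    (l₀ l₁ l₂ : ℝ) (hl₀ : l₀ < 2*β - 2) (hl₁ : β - 2 < l₁) (hl₂ : l₂ < β - 2)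
    (hb₀ : ∀ᵐ x : R2, 1 ≤ ‖x‖ → max (-V x) 0 ≤ C₀ * ‖x‖ ^ l₀)
    (hb₁ : ∀ᵐ x : R2, ‖x‖ ≤ 1 → max (V x) 0 ≤ C₁ * ‖x‖ ^ l₁)
    (hb₂ : ∀ᵐ x : R2, 1 ≤ ‖x‖ → max (V x) 0 ≤ C₂ * ‖x‖ ^ l₂) :
    ∃ ψ : R2 → ℝ, LocallyIntegrable ψ ∧ RadSym ψ ∧ ContDiffOn ℝ 1 ψ {(0:R2)}ᶜ ∧
      (∀ R : ℝ, 0 < R →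
        IntegrableOn (fun x : R2 => ‖gradient ψ x‖ ^ 2) (ball (0:R2) R \ {0})) ∧
      IsWeakSol ψ (fun x => 4 * π * β * V x * Real.exp (ψ x)) ∧
      Integrable (fun x : R2 => |V x| * Real.exp (ψ x)) ∧
      (∫ x : R2, V x * Real.exp (ψ x)) = 1 := by
  obtain ⟨δ, hδ, hA⟩ := exists_integrable_posPart_weightedPotential hVloc hl₁ hl₂ hb₁ hb₂
  obtain ⟨u, c, hint, hone, hueq, hsq⟩ := exists_radial_profile hβ hC hR₁ hR
    (integrable_weightedPotential hβ hVloc hl₀ hl₂ hC₀ hC₂ hb₀ hb₂) hVC hδ hA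
  have hrad : RadSym fun x => V x * Real.exp (u (log ‖x‖)) := fun x y h => by
    dsimp only
    rw [hVrad x y h, h]
  have hderiv : ∀ b, HasDerivAt u (-(2 * β * ∫ y : R2, V y * Real.exp (u (log ‖y‖)) *
      (if log ‖y‖ < b then 1 else 0))) b := fun b => by
    have h := ((hasDerivAt_integral_mul_max hint measurable_log_norm
      (ae_log_norm_ne b)).const_mul (2 * β)).const_sub c
    exact h.congr_of_eventuallyEq (.of_forall hueq)
  have hu : ContDiff ℝ 1 u := by
    rw [contDiff_one_iff_deriv]
    refine ⟨fun b => (hderiv b).differentiableAt, ?_⟩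
    rw [funext fun b => (hderiv b).deriv]
    exact (continuous_const.mul
      (continuous_integral_mul_ite_lt hint measurable_log_norm ae_log_norm_ne)).neg
  have hψloc : LocallyIntegrable fun x : R2 => u (log ‖x‖) := by
    have hlog : LocallyIntegrable fun x : R2 => |log ‖x‖| :=
      locallyIntegrable_log_norm.mono measurable_log_norm.abs.aestronglyMeasurable
        (.of_forall fun x => by simp)
    refine ((locallyIntegrable_const |c|).add (hlog.smul
      (2 * β * ∫ x : R2, |V x * Real.exp (u (log ‖x‖))|))).mono
      (hu.continuous.measurable.comp measurable_log_norm).aestronglyMeasurable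
      (.of_forall fun x => ?_)
    have h1 : |∫ y : R2, V y * Real.exp (u (log ‖y‖)) *
        (max (log ‖x‖) (log ‖y‖) - max 0 (log ‖y‖))| ≤
        (∫ x : R2, |V x * Real.exp (u (log ‖x‖))|) * |log ‖x‖| := by
      rw [← integral_mul_const, ← norm_eq_abs]
      refine norm_integral_le_of_norm_le (hint.abs.mul_const _) (.of_forall fun y => ?_)
      rw [norm_mul, norm_eq_abs, norm_eq_abs]
      exact mul_le_mul_of_nonneg_left (abs_max_sub_max_zero_le _ _) (abs_nonneg _)
    have h2 := mul_le_mul_of_nonneg_left h1 (mul_pos two_pos hβ).le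
    have h3 := abs_sub c (2 * β * ∫ y : R2, V y * Real.exp (u (log ‖y‖)) *
        (max (log ‖x‖) (log ‖y‖) - max 0 (log ‖y‖)))
    rw [abs_mul, abs_of_pos (mul_pos two_pos hβ), ← hueq] at h3
    simp only [Pi.add_apply, Pi.smul_apply, smul_eq_mul, norm_eq_abs]
    refine le_trans ?_ (le_abs_self _)
    linarith
  refine ⟨fun x => u (log ‖x‖), hψloc, fun x y h => by simp only [h], fun x hx => ?_,
    fun R hR' => ?_, ?_, ?_, hone⟩
  · exact (hu.contDiffAt.comp x
      ((contDiffAt_norm ℝ hx).log (norm_ne_zero_iff.2 hx))).contDiffWithinAt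
  · exact (integrableOn_norm_gradient_sq hu (integrableOn_Iio_deriv_sq hu hsq) hR').mono_set
      Set.sdiff_subset
  · simp_rw [mul_assoc (4 * π * β)]
    exact isWeakSol_of_eq_logPotential hint hrad hψloc fun x => hueq (log ‖x‖)
  · simpa only [abs_mul, Real.abs_exp] using hint.abs
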